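/- arXiv:2101.08081 — 2 statements merged into one kernel-verified Lean document; each statement's English description precedes it below -/
import Mathlib

section
/- Let $C \subseteq \mathbb{F}_2^{n_1} \times \mathbb{F}_2^{n_2}$ be a submodule, and define the section shortened codes $S_1 = \{v_1 \in \mathbb{F}_2^{n_1} : (v_1, 0) \in C\}$ and $S_2 = \{v_2 \in \mathbb{F}_2^{n_2} : (0, v_2) \in C\}$. Let $w \in \mathbb{F}_2^{n_1} \times \mathbb{F}_2^{n_2}$ and let $Q_1 : \mathbb{F}_2^{n_1} \to \mathbb{R}$, $Q_2 : \mathbb{F}_2^{n_2} \to \mathbb{R}$. Then $\max_{c \in w + C} \big(Q_1(c_{(1)}) + Q_2(c_{(2)})\big) = \max_{c \in w + C} \Big( \max_{d \in c_{(1)} + S_1} Q_1(d) + \max_{d \in c_{(2)} + S_2} Q_2(d) \Big)$, where $c_{(1)}$ and $c_{(2)}$ denote the two components of $c$. -/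
/-- The first section shortened code `S₁ = {v₁ : (v₁, 0) ∈ C}`. -/
def shortSec1 (n₁ n₂ : ℕ)
    (C : Submodule (ZMod 2) ((Fin n₁ → ZMod 2) × (Fin n₂ → ZMod 2))) :
    Submodule (ZMod 2) (Fin n₁ → ZMod 2) :=
  C.comap (LinearMap.prod LinearMap.id 0)

/-- The second section shortened code `S₂ = {v₂ : (0, v₂) ∈ C}`. -/
def shortSec2 (n₁ n₂ : ℕ)
    (C : Submodule (ZMod 2) ((Fin n₁ → ZMod 2) × (Fin n₂ → ZMod 2))) :
    Submodule (ZMod 2) (Fin n₂ → ZMod 2) :=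
  C.comap (LinearMap.prod 0 LinearMap.id)

/-- Correctness of the RMLD recursion: the maximum correlation over a coset of
`C` splits into maxima over cosets of the shortened section codes. -/
theorem rmld_recursion (n₁ n₂ : ℕ)
    (C : Submodule (ZMod 2) ((Fin n₁ → ZMod 2) × (Fin n₂ → ZMod 2)))
    (w : (Fin n₁ → ZMod 2) × (Fin n₂ → ZMod 2))
    (Q₁ : (Fin n₁ → ZMod 2) → ℝ) (Q₂ : (Fin n₂ → ZMod 2) → ℝ) :
    sSup ((fun c => Q₁ c.1 + Q₂ c.2) ''
        ((fun c => w + c) '' (C : Set ((Fin n₁ → ZMod 2) × (Fin n₂ → ZMod 2))))) =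
      sSup ((fun c =>
          sSup (Q₁ '' ((fun d => c.1 + d) '' (shortSec1 n₁ n₂ C : Set (Fin n₁ → ZMod 2)))) +
          sSup (Q₂ '' ((fun d => c.2 + d) '' (shortSec2 n₁ n₂ C : Set (Fin n₂ → ZMod 2))))) ''
        ((fun c => w + c) '' (C : Set ((Fin n₁ → ZMod 2) × (Fin n₂ → ZMod 2))))) := by
  have fin1 : ∀ s : Set (Fin n₁ → ZMod 2), (Q₁ '' s).Finite := fun s => (Set.toFinite s).image _
  have fin2 : ∀ s : Set (Fin n₂ → ZMod 2), (Q₂ '' s).Finite := fun s => (Set.toFinite s).image _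
  have finp : ∀ (f : (Fin n₁ → ZMod 2) × (Fin n₂ → ZMod 2) → ℝ)
      (s : Set ((Fin n₁ → ZMod 2) × (Fin n₂ → ZMod 2))), (f '' s).Finite :=
    fun f s => (Set.toFinite s).image _
  apply le_antisymm
  · apply csSup_le
    · exact ⟨_, _, ⟨0, C.zero_mem, rfl⟩, rfl⟩
    · rintro _ ⟨_, ⟨c, hc, rfl⟩, rfl⟩
      refine le_trans ?_ (le_csSup (finp _ _).bddAbove ⟨_, ⟨c, hc, rfl⟩, rfl⟩)
      apply add_le_add
      · exact le_csSup (fin1 _).bddAbove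
          ⟨_, ⟨0, (shortSec1 n₁ n₂ C).zero_mem, rfl⟩, by simp⟩
      · exact le_csSup (fin2 _).bddAbove
          ⟨_, ⟨0, (shortSec2 n₁ n₂ C).zero_mem, rfl⟩, by simp⟩
  · apply csSup_le
    · exact ⟨_, _, ⟨0, C.zero_mem, rfl⟩, rfl⟩
    · rintro _ ⟨_, ⟨c, hc, rfl⟩, rfl⟩
      have h1 := Set.Nonempty.csSup_mem (s := Q₁ '' ((fun d => (w + c).1 + d) ''
          (shortSec1 n₁ n₂ C : Set (Fin n₁ → ZMod 2))))
        ⟨_, _, ⟨0, (shortSec1 n₁ n₂ C).zero_mem, rfl⟩, rfl⟩ (fin1 _)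
      have h2 := Set.Nonempty.csSup_mem (s := Q₂ '' ((fun d => (w + c).2 + d) ''
          (shortSec2 n₁ n₂ C : Set (Fin n₂ → ZMod 2))))
        ⟨_, _, ⟨0, (shortSec2 n₁ n₂ C).zero_mem, rfl⟩, rfl⟩ (fin2 _)
      obtain ⟨_, ⟨d1, hd1, rfl⟩, e1⟩ := h1
      obtain ⟨_, ⟨d2, hd2, rfl⟩, e2⟩ := h2
      have k1 : (d1, (0 : Fin n₂ → ZMod 2)) ∈ C := hd1
      have k2 : ((0 : Fin n₁ → ZMod 2), d2) ∈ C := hd2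
      refine le_csSup (finp _ _).bddAbove
        ⟨_, ⟨c + ((d1, 0) + (0, d2)), C.add_mem hc (C.add_mem k1 k2), rfl⟩, ?_⟩
      beta_reduce
      rw [← e1, ← e2]
      simp [add_assoc]
end

section
/- Let $C' \subseteq C \subseteq \mathbb{F}_2^n$ be submodules and $\kappa \in C$ be such that $C$ is generated by $C'$ together with $\kappa$. Let $0 \le x < y \le n$ and suppose $p_{x,y}(C') = p_{x,y}(C)$ and $s_{x,y}(C') = s_{x,y}(C)$. Then for every $w \in \mathbb{F}_2^n$, every $u \in \mathbb{F}_2$, and every function $Q : (\mathrm{Fin}\ (y-x) \to \mathbb{F}_2) \to \mathbb{R}$, the set of real numbers $\big\{ \max_{d \in \pi_{x,y}(w) + e + s_{x,y}(C)} Q(d) \;:\; e \in p_{x,y}(C) \big\}$ equals the set $\big\{ \max_{d \in \pi_{x,y}(w + u\kappa) + e + s_{x,y}(C')} Q(d) \;:\; e \in p_{x,y}(C') \big\}$; that is, the composite branch table constructed for the coset $w + C$ at section $[x,y)$ contains the same values as the one constructed for the coset $(w + u\kappa) + C'$. -/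
/-- The linear restriction map `π_{x,y} : 𝔽₂ⁿ → 𝔽₂^{y-x}`, `(π c)_j = c_{x+j}`. -/
def sectionMap (n x y : ℕ) (hyn : y ≤ n) :
    (Fin n → ZMod 2) →ₗ[ZMod 2] (Fin (y - x) → ZMod 2) where
  toFun c := fun j => c ⟨x + j, by have := j.isLt; omega⟩
  map_add' := by intros; rfl
  map_smul' := by intros; rfl

/-- Vectors that are zero outside positions `x ≤ j < y`. -/
def zeroOutside (n x y : ℕ) : Submodule (ZMod 2) (Fin n → ZMod 2) where
  carrier := {c | ∀ j : Fin n, ((j : ℕ) < x ∨ y ≤ (j : ℕ)) → c j = 0}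
  add_mem' := by intro a b ha hb j hj; simp [Pi.add_apply, ha j hj, hb j hj]
  zero_mem' := by intro j hj; rfl
  smul_mem' := by intro r a ha j hj; simp [Pi.smul_apply, ha j hj]

/-- The punctured section code `p_{x,y}(C)`. -/
def puncture (n x y : ℕ) (hyn : y ≤ n) (C : Submodule (ZMod 2) (Fin n → ZMod 2)) :
    Submodule (ZMod 2) (Fin (y - x) → ZMod 2) :=
  C.map (sectionMap n x y hyn)

/-- The shortened section code `s_{x,y}(C)`. -/
def shorten (n x y : ℕ) (hyn : y ≤ n) (C : Submodule (ZMod 2) (Fin n → ZMod 2)) :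
    Submodule (ZMod 2) (Fin (y - x) → ZMod 2) :=
  (C ⊓ zeroOutside n x y).map (sectionMap n x y hyn)

/-- The set of values stored in the composite branch table for the coset
`w + C` at section `[x, y)`: for each coset index `e ∈ p_{x,y}(C)`, the maximal
value of `Q` over the coset `π_{x,y}(w) + e + s_{x,y}(C)`. -/
noncomputable def cbtValues (n x y : ℕ) (hyn : y ≤ n)
    (C : Submodule (ZMod 2) (Fin n → ZMod 2)) (w : Fin n → ZMod 2)
    (Q : (Fin (y - x) → ZMod 2) → ℝ) : Set ℝ :=
  {r : ℝ | ∃ e ∈ puncture n x y hyn C,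
    r = sSup (Q '' ((fun d => sectionMap n x y hyn w + e + d) ''
      (shorten n x y hyn C : Set (Fin (y - x) → ZMod 2))))}

/-- Lemma 1 of the paper: if the punctured and shortened section codes do not
change from `C'` to `C = C' + ⟨κ⟩`, then the composite branch table built for
the coset `w + C` contains the same values as the one built for `(w + uκ) + C'`. -/
theorem cbt_values_reuse (n x y : ℕ) (hxy : x < y) (hyn : y ≤ n)
    (C C' : Submodule (ZMod 2) (Fin n → ZMod 2)) (κ : Fin n → ZMod 2)
    (hsub : C' ≤ C) (hκ : κ ∈ C)
    (hgen : C = C' ⊔ Submodule.span (ZMod 2) {κ})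
    (hp : puncture n x y hyn C' = puncture n x y hyn C)
    (hs : shorten n x y hyn C' = shorten n x y hyn C)
    (w : Fin n → ZMod 2) (u : ZMod 2) (Q : (Fin (y - x) → ZMod 2) → ℝ) :
    cbtValues n x y hyn C w Q = cbtValues n x y hyn C' (w + u • κ) Q := by
  have hk : sectionMap n x y hyn (u • κ) ∈ puncture n x y hyn C :=
    Submodule.mem_map_of_mem (C.smul_mem u hκ)
  unfold cbtValues
  rw [hp, hs, map_add]
  ext r
  constructor
  · rintro ⟨e, he, rfl⟩
    refine ⟨e - sectionMap n x y hyn (u • κ), Submodule.sub_mem _ he hk, ?_⟩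
    rw [add_assoc (sectionMap n x y hyn w), add_sub_cancel]
  · rintro ⟨e, he, rfl⟩
    refine ⟨sectionMap n x y hyn (u • κ) + e, Submodule.add_mem _ hk he, ?_⟩
    rw [add_assoc (sectionMap n x y hyn w)]
end
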